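/- arXiv:2107.09658 — 9 statements merged into one kernel-verified Lean document; each statement's English description precedes it below -/
import Mathlib

section
/- Let S ≤ S' be additive submonoids of ℕ with S ≠ {0} (the bottom submonoid). Then the following are equivalent: (1) the pair (S, S') is equi-gcd; (2) the conductor is nonzero, i.e. there exists a ∈ S such that a + t ∈ S for every t ∈ S'; (3) the gap set G(S'/S) = S' \ S is finite; (4) the sporadic set N(S'/S) = {a ∈ S : ∃ t ∈ S', a + t ∉ S} is finite. -/
/-- The pair `(S, S')` is equi-gcd: a natural number divides every element of `S`
iff it divides every element of `S'`. -/
def EquiGcd (S S' : AddSubmonoid ℕ) : Prop :=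
  ∀ d : ℕ, (∀ x ∈ S, d ∣ x) ↔ (∀ x ∈ S', d ∣ x)

/-- The gap set `G(S'/S) = S' \ S`. -/
def gapSet (S S' : AddSubmonoid ℕ) : Set ℕ := (S' : Set ℕ) \ (S : Set ℕ)

/-- The sporadic set `N(S'/S)` of elements of `S` not in the conductor. -/
def sporadicSet (S S' : AddSubmonoid ℕ) : Set ℕ :=
  {a : ℕ | a ∈ S ∧ ∃ t ∈ S', a + t ∉ S}

/-- The pseudo-Frobenius set `PF(S'/S)`. -/
def pseudoFrobSet (S S' : AddSubmonoid ℕ) : Set ℕ :=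
  {w : ℕ | w ∈ S' ∧ w ∉ S ∧ ∀ s ∈ S, s ≠ 0 → w + s ∈ S}

/-- The Frobenius set `F(S'/S)`. -/
def frobSet (S S' : AddSubmonoid ℕ) : Set ℕ :=
  {w : ℕ | w ∈ S' ∧ w ∉ S ∧ ∀ t ∈ S', t ≠ 0 → w + t ∈ S}

/-- `S` is irreducible in `S'`. -/
def IrreducibleIn (S S' : AddSubmonoid ℕ) : Prop :=
  ∀ T₁ T₂ : AddSubmonoid ℕ, S ≤ T₁ → T₁ ≤ S' → S ≤ T₂ → T₂ ≤ S' →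
    T₁ ⊓ T₂ = S → T₁ = S ∨ T₂ = S

/-- The fundamental gap set `FG(S'/S)`. -/
def fundGapSet (S S' : AddSubmonoid ℕ) : Set ℕ :=
  {t : ℕ | t ∈ S' ∧ t ∉ S ∧ 2 * t ∈ S ∧ 3 * t ∈ S}

theorem EquiGcd.gapSet_finite {S S' : AddSubmonoid ℕ} (h : EquiGcd S S') :
    (gapSet S S').Finite := by
  obtain ⟨n, hn⟩ := Nat.exists_mem_closure_of_ge (S : Set ℕ)
  rw [AddSubmonoid.closure_eq] at hn
  refine (Set.finite_lt_nat n).subset fun x hx ↦ ?_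
  by_contra hlt
  exact hx.2 <| hn x (not_lt.mp hlt) <|
    (h _).mp (fun _ hy ↦ Nat.setGcd_dvd_of_mem hy) x hx.1

theorem sporadicSet_finite_of_gapSet_finite {S S' : AddSubmonoid ℕ} (hSS' : S ≤ S')
    (h : (gapSet S S').Finite) : (sporadicSet S S').Finite := by
  obtain ⟨b, hb⟩ := h.bddAbove
  refine (Set.finite_le_nat b).subset ?_
  rintro a ⟨ha, t, ht, hat⟩
  exact (Nat.le_add_right a t).trans (hb ⟨S'.add_mem (hSS' ha) ht, hat⟩)

theorem exists_forall_add_mem_of_sporadicSet_finite {S S' : AddSubmonoid ℕ} (hS : S ≠ ⊥)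
    (h : (sporadicSet S S').Finite) : ∃ a ∈ S, ∀ t ∈ S', a + t ∈ S := by
  obtain ⟨s, hs, hs0⟩ := S.bot_or_exists_ne_zero.resolve_left hS
  obtain ⟨b, hb⟩ := h.bddAbove
  refine ⟨(b + 1) • s, S.nsmul_mem hs _, fun t ht ↦ ?_⟩
  by_contra hat
  have hle : (b + 1) • s ≤ b := hb ⟨S.nsmul_mem hs _, t, ht, hat⟩
  rw [smul_eq_mul] at hle
  exact absurd (Nat.le_mul_of_pos_right (b + 1) (Nat.pos_of_ne_zero hs0)) (by omega)

theorem equiGcd_of_forall_add_mem {S S' : AddSubmonoid ℕ} (hSS' : S ≤ S') {a : ℕ} (ha : a ∈ S)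
    (h : ∀ t ∈ S', a + t ∈ S) : EquiGcd S S' := fun _ ↦
  ⟨fun hd t ht ↦ (Nat.dvd_add_right (hd a ha)).mp (hd _ (h t ht)),
    fun hd x hx ↦ hd x (hSS' hx)⟩

theorem equiGcd_tfae (S S' : AddSubmonoid ℕ) (hSS' : S ≤ S') (hS : S ≠ ⊥) :
    [EquiGcd S S',
     ∃ a ∈ S, ∀ t ∈ S', a + t ∈ S,
     (gapSet S S').Finite,
     (sporadicSet S S').Finite].TFAE := by
  tfae_have 1 → 3 := EquiGcd.gapSet_finite
  tfae_have 3 → 4 := sporadicSet_finite_of_gapSet_finite hSS'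
  tfae_have 4 → 2 := exists_forall_add_mem_of_sporadicSet_finite hS
  tfae_have 2 → 1 := fun ⟨_, ha, h⟩ ↦ equiGcd_of_forall_add_mem hSS' ha h
  tfae_finish
end

section
/- Let S ≤ S' be additive submonoids of ℕ with the pair (S, S') equi-gcd, and suppose F(S'/S) = {w} for some w (a single Frobenius element). Then PF(S'/S) = {w} (equivalently, PF(S'/S) is a singleton) if and only if Nat.card (G(S'/S)) = Nat.card (N(S'/S)). -/
theorem finite_gapSet {S S' : AddSubmonoid ℕ} (hgcd : EquiGcd S S') :
    (gapSet S S').Finite := by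
  obtain ⟨n, hn⟩ := Nat.exists_mem_closure_of_ge (S : Set ℕ)
  refine (Set.finite_lt_nat n).subset fun x ⟨hx', hx⟩ => ?_
  by_contra hlt
  refine hx ?_
  have hmem := hn x (not_lt.mp hlt)
    ((hgcd _).mp (fun y hy => Nat.setGcd_dvd_of_mem hy) x hx')
  rwa [AddSubmonoid.closure_eq] at hmem

/-- Every gap lies below a gap that is maximal with respect to adding elements of `T`. -/
theorem exists_add_maximal_gap {S S' T : AddSubmonoid ℕ} (hfin : (gapSet S S').Finite)
    (hT : T ≤ S') {g : ℕ} (hg : g ∈ gapSet S S') :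
    ∃ s ∈ T, g + s ∈ gapSet S S' ∧ ∀ t ∈ T, t ≠ 0 → g + s + t ∈ S := by
  have hfin' : {s | s ∈ T ∧ g + s ∈ gapSet S S'}.Finite :=
    (hfin.preimage (add_right_injective g).injOn).subset fun _ hs => hs.2
  obtain ⟨s, ⟨hsT, hs⟩, hmax⟩ := Set.exists_max_image _ id hfin' ⟨0, T.zero_mem, by simpa using hg⟩
  refine ⟨s, hsT, hs, fun t ht ht0 => ?_⟩
  by_contra hnot
  have hle : s + t ≤ s := hmax (s + t)
    ⟨T.add_mem hsT ht, by rw [← add_assoc]; exact ⟨S'.add_mem hs.1 (hT ht), hnot⟩⟩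
  omega

theorem exists_add_eq_of_mem_gapSet {S S' : AddSubmonoid ℕ} (hfin : (gapSet S S').Finite)
    {w : ℕ} (hw : frobSet S S' = {w}) {g : ℕ} (hg : g ∈ gapSet S S') :
    ∃ t ∈ S', g + t = w := by
  obtain ⟨t, ht, hgt, hmax⟩ := exists_add_maximal_gap hfin le_rfl hg
  have hmem : g + t ∈ frobSet S S' := ⟨hgt.1, hgt.2, hmax⟩
  rw [hw] at hmem
  exact ⟨t, ht, hmem⟩

theorem mem_sporadicSet_iff {S S' : AddSubmonoid ℕ} (hSS' : S ≤ S')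
    (hfin : (gapSet S S').Finite) {w : ℕ} (hw : frobSet S S' = {w}) {a : ℕ} :
    a ∈ sporadicSet S S' ↔ a ∈ S ∧ ∃ t ∈ S', a + t = w := by
  have hwF : w ∈ frobSet S S' := hw ▸ rfl
  refine and_congr_right fun ha => ⟨?_, ?_⟩
  · rintro ⟨t, ht, hat⟩
    obtain ⟨u, hu, hw'⟩ := exists_add_eq_of_mem_gapSet hfin hw ⟨S'.add_mem (hSS' ha) ht, hat⟩
    exact ⟨t + u, S'.add_mem ht hu, by omega⟩
  · rintro ⟨t, ht, rfl⟩
    exact ⟨t, ht, hwF.2.1⟩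

theorem pseudoFrobSet_eq_singleton_iff {S S' : AddSubmonoid ℕ} (hSS' : S ≤ S')
    (hfin : (gapSet S S').Finite) {w : ℕ} (hw : w ∈ frobSet S S') :
    pseudoFrobSet S S' = {w} ↔ ∀ g ∈ gapSet S S', ∃ s ∈ S, g + s = w := by
  constructor
  · intro hPF g hg
    obtain ⟨s, hs, hgs, hmax⟩ := exists_add_maximal_gap hfin hSS' hg
    have hmem : g + s ∈ pseudoFrobSet S S' := ⟨hgs.1, hgs.2, hmax⟩
    rw [hPF] at hmem
    exact ⟨s, hs, hmem⟩
  · intro h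
    refine Set.Subset.antisymm ?_ (Set.singleton_subset_iff.mpr
      ⟨hw.1, hw.2.1, fun s hs => hw.2.2 s (hSS' hs)⟩)
    rintro g ⟨hg', hg, hmax⟩
    obtain ⟨s, hs, hgs⟩ := h g ⟨hg', hg⟩
    rcases eq_or_ne s 0 with rfl | hs0
    · simpa using hgs
    · exact absurd (hgs ▸ hmax s hs hs0) hw.2.1

theorem singleton_pf_iff_card_eq (S S' : AddSubmonoid ℕ) (hSS' : S ≤ S')
    (hgcd : EquiGcd S S') (w : ℕ) (hw : frobSet S S' = {w}) :
    pseudoFrobSet S S' = {w} ↔ Nat.card (gapSet S S') = Nat.card (sporadicSet S S') := by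
  have hfin := finite_gapSet hgcd
  have hwF : w ∈ frobSet S S' := hw ▸ rfl
  have hN {a : ℕ} := mem_sporadicSet_iff hSS' hfin hw (a := a)
  have hinj : Set.InjOn (fun a => w - a) (sporadicSet S S') := by
    intro a ha b hb hab
    obtain ⟨-, t, -, ht⟩ := hN.mp ha
    obtain ⟨-, u, -, hu⟩ := hN.mp hb
    dsimp only at hab
    omega
  have hsub : (fun a => w - a) '' sporadicSet S S' ⊆ gapSet S S' := by
    rintro _ ⟨a, ha, rfl⟩
    obtain ⟨haS, t, ht, rfl⟩ := hN.mp ha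
    dsimp only
    rw [Nat.add_sub_cancel_left]
    exact ⟨ht, fun htS => hwF.2.1 (S.add_mem haS htS)⟩
  rw [pseudoFrobSet_eq_singleton_iff hSS' hfin hwF, Nat.card_coe_set_eq, Nat.card_coe_set_eq,
    ← hinj.ncard_image]
  constructor
  · intro h
    congr 1
    refine Set.Subset.antisymm (fun g hg => ?_) hsub
    obtain ⟨s, hs, hgs⟩ := h g hg
    exact ⟨s, hN.mpr ⟨hs, g, hg.1, by omega⟩, by dsimp only; omega⟩
  · intro hcard g hg
    rw [← Set.eq_of_subset_of_ncard_le hsub hcard.le hfin] at hg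
    obtain ⟨a, ha, rfl⟩ := hg
    obtain ⟨haS, t, -, ht⟩ := hN.mp ha
    exact ⟨a, haS, by dsimp only; omega⟩
end

section
/- Let S ≤ S' be additive submonoids of ℕ with the pair (S, S') equi-gcd, and let w ∈ S' \ S. The following are equivalent: (1) S is irreducible in S' and F(S'/S) = {w}; (2) F(S'/S) = {w} and S is maximal with respect to inclusion among additive submonoids T with S ≤ T ≤ S' and F(S'/T) = {w}, i.e. every such T containing S equals S; (3) w ∈ F(S'/S) and S is maximal with respect to inclusion among additive submonoids T with S ≤ T ≤ S' and w ∈ F(S'/T). -/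
/-- A submonoid enlarged by one element of its Frobenius set. -/
def adjoinFrob (S S' : AddSubmonoid ℕ) (f : ℕ) (hSS' : S ≤ S') (hf : f ∈ frobSet S S') :
    AddSubmonoid ℕ where
  carrier := {x | x ∈ S ∨ x = f}
  zero_mem' := Or.inl S.zero_mem
  add_mem' := by
    obtain ⟨hfS', hfS, hadd⟩ := hf
    have hf0 : f ≠ 0 := fun h => hfS (h ▸ S.zero_mem)
    rintro a b (ha | rfl) (hb | rfl)
    · exact Or.inl (S.add_mem ha hb)
    · rcases eq_or_ne a 0 with rfl | ha0
      · exact Or.inr (zero_add _)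
      · exact Or.inl (add_comm a b ▸ hadd a (hSS' ha) ha0)
    · rcases eq_or_ne b 0 with rfl | hb0
      · exact Or.inr (add_zero _)
      · exact Or.inl (hadd b (hSS' hb) hb0)
    · exact Or.inl (hadd b hfS' hf0)

theorem mem_adjoinFrob {S S' : AddSubmonoid ℕ} {f x : ℕ} {hSS' : S ≤ S'}
    {hf : f ∈ frobSet S S'} : x ∈ adjoinFrob S S' f hSS' hf ↔ x ∈ S ∨ x = f :=
  Iff.rfl

theorem le_adjoinFrob {S S' : AddSubmonoid ℕ} {f : ℕ} (hSS' : S ≤ S')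
    (hf : f ∈ frobSet S S') : S ≤ adjoinFrob S S' f hSS' hf :=
  fun _ hx => Or.inl hx

theorem adjoinFrob_le {S S' : AddSubmonoid ℕ} {f : ℕ} (hSS' : S ≤ S')
    (hf : f ∈ frobSet S S') : adjoinFrob S S' f hSS' hf ≤ S' := by
  rintro x (hx | rfl)
  · exact hSS' hx
  · exact hf.1

theorem adjoinFrob_ne {S S' : AddSubmonoid ℕ} {f : ℕ} (hSS' : S ≤ S')
    (hf : f ∈ frobSet S S') : adjoinFrob S S' f hSS' hf ≠ S := fun h =>
  hf.2.1 (h ▸ mem_adjoinFrob.2 (Or.inr rfl))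

/-- A Frobenius element persists in every larger submonoid not containing it. -/
theorem mem_frobSet_of_le {S S' T : AddSubmonoid ℕ} {w : ℕ} (hw : w ∈ frobSet S S')
    (hST : S ≤ T) (hwT : w ∉ T) : w ∈ frobSet T S' :=
  ⟨hw.1, hwT, fun t ht ht0 => hST (hw.2.2 t ht ht0)⟩

theorem frobSet_eq_singleton_of_maximal {S S' : AddSubmonoid ℕ} {w : ℕ} (hSS' : S ≤ S')
    (hw : w ∈ frobSet S S')
    (hmax : ∀ T : AddSubmonoid ℕ, S ≤ T → T ≤ S' → w ∈ frobSet T S' → T = S) :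
    frobSet S S' = {w} := by
  refine Set.Subset.antisymm (fun f hf => ?_) (Set.singleton_subset_iff.2 hw)
  by_contra hne
  refine adjoinFrob_ne hSS' hf (hmax _ (le_adjoinFrob hSS' hf) (adjoinFrob_le hSS' hf)
    (mem_frobSet_of_le hw (le_adjoinFrob hSS' hf) ?_))
  rintro (h | h)
  · exact hw.2.1 h
  · exact hne h.symm

/-- A submonoid of `S'` avoiding `w` is contained in a maximal one. -/
theorem exists_le_maximal_notMem {S' T : AddSubmonoid ℕ} {w : ℕ} (hTS' : T ≤ S')
    (hwT : w ∉ T) :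
    ∃ M : AddSubmonoid ℕ, T ≤ M ∧ Maximal (fun U : AddSubmonoid ℕ => U ≤ S' ∧ w ∉ U) M := by
  refine zorn_le_nonempty₀ {U : AddSubmonoid ℕ | U ≤ S' ∧ w ∉ U} (fun c hc hchain U hU => ?_)
    T ⟨hTS', hwT⟩
  refine ⟨sSup c, ⟨sSup_le fun V hV => (hc hV).1, fun h => ?_⟩, fun V hV => le_sSup hV⟩
  obtain ⟨V, hV, hwV⟩ := (AddSubmonoid.mem_sSup_of_directedOn ⟨U, hU⟩ hchain.directedOn).1 h
  exact (hc hV).2 hwV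

theorem irreducible_iff_maximal (S S' : AddSubmonoid ℕ) (hSS' : S ≤ S')
    (hgcd : EquiGcd S S') (w : ℕ) (hw : w ∈ S') (hw' : w ∉ S) :
    [IrreducibleIn S S' ∧ frobSet S S' = {w},
     frobSet S S' = {w} ∧
       ∀ T : AddSubmonoid ℕ, S ≤ T → T ≤ S' → frobSet T S' = {w} → T = S,
     w ∈ frobSet S S' ∧
       ∀ T : AddSubmonoid ℕ, S ≤ T → T ≤ S' → w ∈ frobSet T S' → T = S].TFAE := by
  tfae_have 1 → 2 := by
    rintro ⟨hirr, hF⟩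
    refine ⟨hF, fun T hST hTS' hT => ?_⟩
    have hwF : w ∈ frobSet S S' := hF ▸ Set.mem_singleton w
    have hwT : w ∈ frobSet T S' := hT ▸ Set.mem_singleton w
    refine (hirr T _ hST hTS' (le_adjoinFrob hSS' hwF) (adjoinFrob_le hSS' hwF) ?_).resolve_right
      (adjoinFrob_ne hSS' hwF)
    refine le_antisymm ?_ (le_inf hST (le_adjoinFrob hSS' hwF))
    rintro x ⟨hxT, hxS | rfl⟩
    · exact hxS
    · exact absurd hxT hwT.2.1
  tfae_have 2 → 3 := by
    rintro ⟨hF, hmax⟩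
    have hwF : w ∈ frobSet S S' := hF ▸ Set.mem_singleton w
    refine ⟨hwF, fun T hST hTS' hT => ?_⟩
    obtain ⟨M, hTM, hM⟩ := exists_le_maximal_notMem hTS' hT.2.1
    have hSM := hST.trans hTM
    have hMS : M = S := hmax M hSM hM.prop.1 <|
      frobSet_eq_singleton_of_maximal hM.prop.1 (mem_frobSet_of_le hwF hSM hM.prop.2)
        fun U hMU hUS' hU => le_antisymm (hM.le_of_ge ⟨hUS', hU.2.1⟩ hMU) hMU
    exact le_antisymm (hMS ▸ hTM) hST
  tfae_have 3 → 1 := by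
    rintro ⟨hwF, hmax⟩
    refine ⟨fun T₁ T₂ h₁ h₁' h₂ h₂' hinf => ?_, frobSet_eq_singleton_of_maximal hSS' hwF hmax⟩
    by_cases hwT : w ∈ T₁
    · refine Or.inr (hmax T₂ h₂ h₂' (mem_frobSet_of_le hwF h₂ fun h => hw' ?_))
      exact hinf ▸ AddSubmonoid.mem_inf.2 ⟨hwT, h⟩
    · exact Or.inl (hmax T₁ h₁ h₁' (mem_frobSet_of_le hwF h₁ hwT))
  tfae_finish
end

section
/- Let S ≤ S' be additive submonoids of ℕ with the pair (S, S') equi-gcd and F(S'/S) = {w}. Let s ∈ PF(S'/S) and suppose that n * s ≠ w for every n ∈ ℕ (s is not a radical of w). Let T be the additive submonoid of ℕ generated by S ∪ {s}. Then F(S'/T) = {w}. -/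
/-- For an equi-gcd pair, all sufficiently large elements of `S'` lie in `S`. -/
theorem EquiGcd.exists_forall_ge_mem {S S' : AddSubmonoid ℕ} (h : EquiGcd S S') :
    ∃ N, ∀ x ∈ S', N ≤ x → x ∈ S := by
  obtain ⟨N, hN⟩ := Nat.exists_mem_closure_of_ge (S : Set ℕ)
  refine ⟨N, fun x hx hNx => ?_⟩
  have hdvd : Nat.setGcd (S : Set ℕ) ∣ x :=
    (h _).1 (fun y hy => Nat.setGcd_dvd_of_mem hy) x hx
  simpa using hN x hNx hdvd

/-- For an equi-gcd pair, every gap lies below an element of the Frobenius set. -/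
theorem EquiGcd.exists_add_mem_frobSet {S S' : AddSubmonoid ℕ} (h : EquiGcd S S') {x : ℕ}
    (hx : x ∈ S') (hxS : x ∉ S) : ∃ t ∈ S', x + t ∈ frobSet S S' := by
  obtain ⟨N, hN⟩ := h.exists_forall_ge_mem
  induction hk : N - x using Nat.strong_induction_on generalizing x with
  | _ k ih =>
    by_cases hF : x ∈ frobSet S S'
    · exact ⟨0, S'.zero_mem, by simpa using hF⟩
    · obtain ⟨t, ht, ht0, htS⟩ : ∃ t ∈ S', t ≠ 0 ∧ x + t ∉ S := by
        by_contra! hc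
        exact hF ⟨hx, hxS, hc⟩
      have hlt : x < N := lt_of_not_ge fun hge => hxS (hN x hx hge)
      obtain ⟨u, hu, hxu⟩ := ih (N - (x + t)) (by omega) (S'.add_mem hx ht) htS rfl
      exact ⟨t + u, S'.add_mem ht hu, by rwa [← add_assoc]⟩

/-- Adjoining a pseudo-Frobenius element `s` to `S` only adds multiples of `s`. -/
theorem mem_or_exists_mul_of_mem_closure {S S' : AddSubmonoid ℕ} {s x : ℕ}
    (hs : s ∈ pseudoFrobSet S S') (hx : x ∈ AddSubmonoid.closure ((S : Set ℕ) ∪ {s})) :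
    x ∈ S ∨ ∃ n : ℕ, n * s = x := by
  have key : ∀ y ∈ S, y ≠ 0 → ∀ n : ℕ, n * s + y ∈ S := by
    intro y hy hy0 n
    induction n with
    | zero => simpa using hy
    | succ n ih =>
      have := hs.2.2 _ ih (by omega)
      rwa [← add_assoc, add_comm s, ← Nat.succ_mul] at this
  have mixed : ∀ y ∈ S, ∀ n : ℕ, n * s + y ∈ S ∨ ∃ m : ℕ, m * s = n * s + y := by
    intro y hy n
    rcases eq_or_ne y 0 with rfl | hy0
    · exact Or.inr ⟨n, rfl⟩
    · exact Or.inl (key y hy hy0 n)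
  induction hx using AddSubmonoid.closure_induction with
  | mem y hy =>
    rcases hy with hy | rfl
    · exact Or.inl hy
    · exact Or.inr ⟨1, one_mul _⟩
  | zero => exact Or.inl S.zero_mem
  | add y z _ _ hy hz =>
    rcases hy with hy | ⟨m, rfl⟩ <;> rcases hz with hz | ⟨n, rfl⟩
    · exact Or.inl (S.add_mem hy hz)
    · simpa only [add_comm y] using mixed y hy n
    · exact mixed z hz m
    · exact Or.inr ⟨m + n, add_mul m n s⟩

theorem frob_of_join_pseudoFrob (S S' : AddSubmonoid ℕ) (hSS' : S ≤ S')
    (hgcd : EquiGcd S S') (w s : ℕ) (hw : frobSet S S' = {w})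
    (hs : s ∈ pseudoFrobSet S S') (hrad : ∀ n : ℕ, n * s ≠ w) :
    frobSet (AddSubmonoid.closure ((S : Set ℕ) ∪ {s})) S' = {w} := by
  have hST : S ≤ AddSubmonoid.closure ((S : Set ℕ) ∪ {s}) := fun x hx =>
    AddSubmonoid.subset_closure (Or.inl hx)
  have hwF : w ∈ frobSet S S' := hw ▸ Set.mem_singleton w
  obtain ⟨hwS', hwS, hwadd⟩ := hwF
  have hwT : w ∉ AddSubmonoid.closure ((S : Set ℕ) ∪ {s}) := by
    intro hmem
    rcases mem_or_exists_mul_of_mem_closure hs hmem with h | ⟨n, hn⟩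
    · exact hwS h
    · exact hrad n hn
  refine Set.eq_singleton_iff_unique_mem.2
    ⟨⟨hwS', hwT, fun t ht ht0 => hST (hwadd t ht ht0)⟩, ?_⟩
  rintro v ⟨hvS', hvT, hvadd⟩
  obtain ⟨t, ht, hvt⟩ := hgcd.exists_add_mem_frobSet hvS' fun hv => hvT (hST hv)
  rw [hw, Set.mem_singleton_iff] at hvt
  rcases eq_or_ne t 0 with rfl | ht0
  · exact hvt
  · exact absurd (hvt ▸ hvadd t ht ht0) hwT
end

section
/- Let S ≤ S' be additive submonoids of ℕ with the pair (S, S') equi-gcd, and let s ∈ S with s ≠ 0. Set D := Ap(S, s) \ Ap(S', s). Then for every w ∈ ℕ: w ∈ PF(S'/S) if and only if w + s ∈ D and w + s is maximal in D with respect to the order ≼_S (i.e. for every y ∈ D with ∃ a ∈ S, y = (w + s) + a, one has y = w + s). -/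
/-- The Apéry set of `T` relative to `s`. -/
def aperySet (T : AddSubmonoid ℕ) (s : ℕ) : Set ℕ :=
  {x : ℕ | x ∈ T ∧ ∀ y ∈ T, x ≠ y + s}

theorem mem_aperySet_diff_iff {S S' : AddSubmonoid ℕ} (hSS' : S ≤ S') {s w : ℕ} :
    w + s ∈ aperySet S s \ aperySet S' s ↔ w + s ∈ S ∧ w ∈ S' ∧ w ∉ S := by
  constructor
  · rintro ⟨⟨hS, hne⟩, hn⟩
    refine ⟨hS, ?_, fun hw => hne w hw rfl⟩
    by_contra hw
    refine hn ⟨hSS' hS, fun y hy h => hw ?_⟩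
    rwa [Nat.add_right_cancel h]
  · rintro ⟨hS, hw', hw⟩
    refine ⟨⟨hS, fun y hy h => hw ?_⟩, fun h => h.2 w hw' rfl⟩
    rwa [Nat.add_right_cancel h]

theorem pseudoFrob_via_apery (S S' : AddSubmonoid ℕ) (hSS' : S ≤ S')
    (hgcd : EquiGcd S S') (s : ℕ) (hs : s ∈ S) (hs0 : s ≠ 0) :
    ∀ w : ℕ, w ∈ pseudoFrobSet S S' ↔
      (w + s ∈ aperySet S s \ aperySet S' s ∧
       ∀ y ∈ aperySet S s \ aperySet S' s, (∃ a ∈ S, y = (w + s) + a) → y = w + s) := by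
  intro w
  rw [mem_aperySet_diff_iff hSS']
  constructor
  · rintro ⟨hw', hw, hadd⟩
    refine ⟨⟨hadd s hs hs0, hw', hw⟩, ?_⟩
    rintro y hy ⟨a, ha, rfl⟩
    by_contra hne
    exact hy.1.2 (w + a) (hadd a ha (by omega)) (by omega)
  · rintro ⟨⟨hws, hw', hw⟩, hmax⟩
    refine ⟨hw', hw, fun a ha ha0 => ?_⟩
    by_contra hwa
    have hD : w + a + s ∈ aperySet S s \ aperySet S' s :=
      (mem_aperySet_diff_iff hSS').2
        ⟨by simpa only [add_right_comm] using S.add_mem hws ha,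
          S'.add_mem hw' (hSS' ha), hwa⟩
    have := hmax _ hD ⟨a, ha, by omega⟩
    omega
end

section
/- Let S' be an additive submonoid of ℕ with S' ≠ ℕ and ℕ \ S' finite, and let w be the largest element of ℕ \ S' (the Frobenius number of S'). Let n ≥ 2 and h ∈ ℕ satisfy h > 2*n*w and n ∤ h. Let T₀ be the additive submonoid of ℕ generated by {n*s : s ∈ S'} ∪ {h+1, h+2, …, 2h+1}, and let T₁ be the additive submonoid generated by T₀ ∪ {h - n*g : g ∈ ℕ \ S'}. Then T₁ \ T₀ = {h - n*g : g ∈ ℕ \ S'}. -/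
/-- The interval `[h + 1, 2h + 1]` generates everything above `h`. -/
theorem mem_closure_Icc_of_lt {h x : ℕ} (hx : h < x) :
    x ∈ AddSubmonoid.closure (Set.Icc (h + 1) (2 * h + 1)) := by
  induction x using Nat.strong_induction_on with
  | _ x ih =>
    by_cases hle : x ≤ 2 * h + 1
    · exact AddSubmonoid.subset_closure ⟨hx, hle⟩
    · have hsum := add_mem (ih (x - (h + 1)) (by omega) (by omega))
        (AddSubmonoid.subset_closure (show h + 1 ∈ Set.Icc (h + 1) (2 * h + 1) by
          constructor <;> omega))
      rwa [Nat.sub_add_cancel (by omega)] at hsum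

theorem mem_closure_image_mul_union_Icc {S : AddSubmonoid ℕ} {n h x : ℕ} :
    x ∈ AddSubmonoid.closure
      ((fun s => n * s) '' (S : Set ℕ) ∪ Set.Icc (h + 1) (2 * h + 1)) ↔
      (∃ s ∈ S, n * s = x) ∨ h < x := by
  constructor
  · intro hx
    induction hx using AddSubmonoid.closure_induction with
    | mem x hx => exact hx.imp id fun hx => hx.1
    | zero => exact Or.inl ⟨0, zero_mem S, mul_zero n⟩
    | add x y _ _ hx hy =>
      rcases hx with ⟨s, hs, rfl⟩ | hx
      · rcases hy with ⟨t, ht, rfl⟩ | hy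
        · exact Or.inl ⟨s + t, add_mem hs ht, mul_add n s t⟩
        · exact Or.inr (by omega)
      · exact Or.inr (by omega)
  · rintro (hx | hx)
    · exact AddSubmonoid.subset_closure (Or.inl hx)
    · exact AddSubmonoid.closure_mono Set.subset_union_right (mem_closure_Icc_of_lt hx)

/-- Adding `n * s`, or anything above `h`, to a reflected gap `h - n * g` gives either another
reflected gap or an element above `h`. -/
theorem sub_mul_add_mem {S : AddSubmonoid ℕ} {n h g y : ℕ} (hn : 0 < n) (hg : g ∉ S)
    (hgh : n * g ≤ h) (hy : (∃ s ∈ S, n * s = y) ∨ h < y) :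
    h < h - n * g + y ∨ ∃ g' ∉ S, h - n * g' = h - n * g + y := by
  rcases hy with ⟨s, hs, rfl⟩ | hy
  · rcases lt_or_ge g s with hlt | hle
    · have := Nat.mul_lt_mul_of_pos_left hlt hn
      exact Or.inl (by omega)
    · obtain ⟨d, rfl⟩ := Nat.exists_eq_add_of_le hle
      refine Or.inr ⟨d, fun hd => hg (add_mem hs hd), ?_⟩
      rw [mul_add] at hgh ⊢
      omega
  · exact Or.inl (by omega)

theorem gaps_of_radical_construction (S' : AddSubmonoid ℕ) (hne : S' ≠ ⊤)
    (hfin : ((S' : Set ℕ)ᶜ).Finite) (w : ℕ) (hw : IsGreatest ((S' : Set ℕ)ᶜ) w)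
    (n h : ℕ) (hn : 2 ≤ n) (hh : 2 * n * w < h) (hnh : ¬ n ∣ h)
    (T₀ T₁ : AddSubmonoid ℕ)
    (hT₀ : T₀ = AddSubmonoid.closure
      ((fun s => n * s) '' (S' : Set ℕ) ∪ Set.Icc (h + 1) (2 * h + 1)))
    (hT₁ : T₁ = AddSubmonoid.closure
      ((T₀ : Set ℕ) ∪ (fun g => h - n * g) '' ((S' : Set ℕ)ᶜ))) :
    (T₁ : Set ℕ) \ (T₀ : Set ℕ) = (fun g => h - n * g) '' ((S' : Set ℕ)ᶜ) := by
  subst hT₀ hT₁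
  have hgap : ∀ g ∉ S', 2 * (n * g) < h := fun g hg => by
    have := Nat.mul_le_mul_left n (hw.2 hg)
    have : 2 * n * w = 2 * (n * w) := mul_assoc 2 n w
    omega
  ext x
  constructor
  · rintro ⟨hx, hx₀⟩
    suffices hmem : ((∃ s ∈ S', n * s = x) ∨ h < x) ∨ ∃ g ∉ S', h - n * g = x from
      hmem.resolve_left fun hx' => hx₀ (mem_closure_image_mul_union_Icc.2 hx')
    clear hx₀
    induction hx using AddSubmonoid.closure_induction with
    | mem x hx => exact hx.imp mem_closure_image_mul_union_Icc.1 id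
    | zero => exact Or.inl (Or.inl ⟨0, zero_mem S', mul_zero n⟩)
    | add x y _ _ hx hy =>
      rcases hx with hx | ⟨g, hg, rfl⟩
      · rcases hy with hy | ⟨g, hg, rfl⟩
        · rw [← mem_closure_image_mul_union_Icc] at hx hy ⊢
          exact Or.inl (add_mem hx hy)
        · have := hgap g hg
          rw [add_comm]
          exact (sub_mul_add_mem (by omega) hg (by omega) hx).imp_left Or.inr
      · have := hgap g hg
        rcases hy with hy | ⟨g', hg', rfl⟩
        · exact (sub_mul_add_mem (by omega) hg (by omega) hy).imp_left Or.inr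
        · have := hgap g' hg'
          exact Or.inl (Or.inr (by omega))
  · rintro ⟨g, hg, rfl⟩
    refine ⟨AddSubmonoid.subset_closure (Or.inr ⟨g, hg, rfl⟩), fun hmem => ?_⟩
    have := hgap g hg
    rcases mem_closure_image_mul_union_Icc.1 hmem with ⟨s, -, hs⟩ | hlt
    · exact hnh ⟨s + g, by dsimp only at hs; rw [mul_add]; omega⟩
    · dsimp only at hlt
      omega
end

section
/- Let S' ≤ S'' be additive submonoids of ℕ with S' ≠ {0} and the pair (S', S'') equi-gcd. Then for every n ≥ 2, the set of additive submonoids S of ℕ such that S ≤ S'', the pair (S, S'') is equi-gcd, {t ∈ S'' : n * t ∈ S} = (S' : Set ℕ) (i.e. S' is the n-th radical of S in S''), and S is symmetric in S'' (i.e. PF(S''/S) = {w} for some w), is infinite. -/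
/-- The submonoid of `S` obtained from `T` by adjoining every `x ∈ S` with `w < 2 * x` and
`w - x ∉ T` (the difference being taken in `ℤ`). -/
def symmetrization (T S : AddSubmonoid ℕ) (w : ℕ) : AddSubmonoid ℕ where
  carrier := {x | x ∈ S ∧ (x ∈ T ∨ (w < 2 * x ∧ ∀ y ∈ T, x + y ≠ w))}
  zero_mem' := ⟨S.zero_mem, Or.inl T.zero_mem⟩
  add_mem' := by
    rintro a b ⟨ha, ha'⟩ ⟨hb, hb'⟩
    refine ⟨S.add_mem ha hb, ?_⟩
    rcases ha' with ha' | ⟨ha₁, ha₂⟩ <;> rcases hb' with hb' | ⟨hb₁, hb₂⟩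
    · exact Or.inl (T.add_mem ha' hb')
    · refine Or.inr ⟨by omega, fun y hy h => hb₂ (a + y) (T.add_mem ha' hy) (by omega)⟩
    · refine Or.inr ⟨by omega, fun y hy h => ha₂ (b + y) (T.add_mem hb' hy) (by omega)⟩
    · exact Or.inr ⟨by omega, fun y _ h => by omega⟩

section symmetrization

variable {T S : AddSubmonoid ℕ} {w : ℕ}

theorem mem_symmetrization {x : ℕ} :
    x ∈ symmetrization T S w ↔ x ∈ S ∧ (x ∈ T ∨ (w < 2 * x ∧ ∀ y ∈ T, x + y ≠ w)) :=
  Iff.rfl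

theorem symmetrization_le : symmetrization T S w ≤ S := fun _ hx => hx.1

theorem le_symmetrization (hTS : T ≤ S) : T ≤ symmetrization T S w := fun _ hx => ⟨hTS hx, Or.inl hx⟩

theorem mem_symmetrization_of_lt {x : ℕ} (hx : x ∈ S) (hwx : w < x) :
    x ∈ symmetrization T S w :=
  ⟨hx, Or.inr ⟨by omega, fun y _ h => by omega⟩⟩

theorem equiGcd_symmetrization : EquiGcd (symmetrization T S w) S := by
  refine fun d => ⟨fun h x hx => ?_, fun h x hx => h x hx.1⟩
  rcases Nat.eq_zero_or_pos x with rfl | hpos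
  · exact dvd_zero d
  have hmul : (w + 1) * x ∈ S := by simpa using S.nsmul_mem hx (w + 1)
  have hlt : w < (w + 1) * x := by nlinarith
  exact (Nat.dvd_add_right (h _ (mem_symmetrization_of_lt hmul hlt))).1
    (h _ (mem_symmetrization_of_lt (S.add_mem hmul hx) (by omega)))

/-- If `w` is not twice an element of `S` and `w - x ∈ S` for every `x ∈ S` below `w / 2`, then
`w` is the only pseudo-Frobenius element of the symmetrization at `w`. -/
theorem pseudoFrobSet_symmetrization (hTS : T ≤ S) (hwS : w ∈ S) (hwT : w ∉ T) (hodd : ∀ x ∈ S, 2 * x ≠ w)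
    (hsub : ∀ x ∈ S, 2 * x < w → w - x ∈ S) :
    pseudoFrobSet (symmetrization T S w) S = {w} := by
  have hw : w ∉ symmetrization T S w := by
    rintro ⟨-, h | ⟨-, h⟩⟩
    · exact hwT h
    · exact h 0 T.zero_mem (by omega)
  ext x
  refine ⟨?_, ?_⟩
  · rintro ⟨hxS, hx, hadd⟩
    have hcomp : ∃ s ∈ symmetrization T S w, x + s = w := by
      by_cases hlt : w < 2 * x
      · by_contra! hne
        exact hx ⟨hxS, Or.inr ⟨hlt, fun y hy => hne y (le_symmetrization hTS hy)⟩⟩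
      · have hlt' : 2 * x < w := by have := hodd x hxS; omega
        refine ⟨w - x, ⟨hsub x hxS hlt', Or.inr ⟨by omega, fun y hy h => ?_⟩⟩, by omega⟩
        obtain rfl : y = x := by omega
        exact hx (le_symmetrization hTS hy)
    obtain ⟨s, hs, hxs⟩ := hcomp
    by_cases hs0 : s = 0
    · simpa [hs0] using hxs
    · exact absurd (hxs ▸ hadd s hs hs0) hw
  · rintro rfl
    exact ⟨hwS, hw, fun s hs hs0 =>
      mem_symmetrization_of_lt (S.add_mem hwS (symmetrization_le hs)) (by omega)⟩

end symmetrization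

theorem infinitely_many_symmetric_radicals (S' S'' : AddSubmonoid ℕ) (hle : S' ≤ S'')
    (hS' : S' ≠ ⊥) (hgcd : EquiGcd S' S'') (n : ℕ) (hn : 2 ≤ n) :
    {S : AddSubmonoid ℕ | S ≤ S'' ∧ EquiGcd S S'' ∧
      {t : ℕ | t ∈ S'' ∧ n * t ∈ S} = (S' : Set ℕ) ∧
      ∃ w : ℕ, pseudoFrobSet S S'' = {w}}.Infinite := by
  obtain ⟨d, N, hd', hN⟩ : ∃ d N, (∀ x ∈ S', d ∣ x) ∧ ∀ m ≥ N, d ∣ m → m ∈ S' := by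
    obtain ⟨N, hN⟩ := Nat.exists_mem_closure_of_ge (S' : Set ℕ)
    exact ⟨Nat.setGcd S', N, fun x hx => Nat.setGcd_dvd_of_mem hx, by simpa using hN⟩
  have hd'' := (hgcd d).1 hd'
  have hd : 0 < d := by
    refine Nat.pos_of_ne_zero fun h => hS' ((AddSubmonoid.eq_bot_iff_forall S').2 fun x hx => ?_)
    simpa [h] using hd' x hx
  let T : AddSubmonoid ℕ := S'.map (AddMonoidHom.mulLeft n)
  have hTS : T ≤ S'' := by
    rintro _ ⟨t, ht, rfl⟩
    simpa using S''.nsmul_mem (hle ht) n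
  let w : ℕ → ℕ := fun k => d * (2 * n * (N + k) + 1)
  have hw_le (k : ℕ) : 2 * n * N ≤ w k := by
    calc 2 * n * N ≤ 2 * n * (N + k) + 1 := by nlinarith
      _ ≤ w k := Nat.le_mul_of_pos_left _ hd
  have hpf (k : ℕ) : pseudoFrobSet (symmetrization T S'' (w k)) S'' = {w k} := by
    have hdw : d ∣ w k := dvd_mul_right _ _
    have hNw : 4 * N ≤ w k := by nlinarith [hw_le k]
    refine pseudoFrobSet_symmetrization hTS (hle (hN _ (by omega) hdw)) ?_ ?_ ?_
    · rintro ⟨t, ht, htw⟩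
      obtain ⟨c, rfl⟩ := hd' t ht
      have h : n * c = 2 * n * (N + k) + 1 := by
        apply Nat.eq_of_mul_eq_mul_left hd
        simpa [w, mul_left_comm] using htw
      have h1 : n ∣ 1 := by
        refine (Nat.dvd_add_right (dvd_mul_right n (2 * (N + k)))).1 ⟨c, ?_⟩
        rw [h]; ring
      have := Nat.le_of_dvd one_pos h1
      omega
    · intro x hx hxw
      obtain ⟨c, rfl⟩ := hd'' x hx
      have h : 2 * c = 2 * n * (N + k) + 1 := by
        apply Nat.eq_of_mul_eq_mul_left hd
        simpa [w, mul_left_comm] using hxw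
      rw [mul_assoc] at h
      omega
    · intro x hx hxw
      exact hle (hN _ (by omega) (Nat.dvd_sub hdw (hd'' x hx)))
  refine Set.infinite_of_injective_forall_mem
    (f := fun k : ℕ => symmetrization T S'' (w k)) ?_ ?_
  · intro k l hkl
    have h : w k = w l := by
      rw [← Set.singleton_eq_singleton_iff, ← hpf k, ← hpf l]
      exact congrArg (pseudoFrobSet · S'') hkl
    have h' := Nat.eq_of_mul_eq_mul_left hd h
    have := Nat.eq_of_mul_eq_mul_left (by omega : 0 < 2 * n) (Nat.add_right_cancel h')
    omega
  · refine fun k => ⟨symmetrization_le, equiGcd_symmetrization, ?_, _, hpf k⟩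
    ext t
    refine ⟨?_, fun ht => ⟨hle ht, le_symmetrization hTS ⟨t, ht, rfl⟩⟩⟩
    rintro ⟨ht, -, ⟨u, hu, hut⟩ | ⟨hlt, -⟩⟩
    · rwa [← Nat.eq_of_mul_eq_mul_left (by omega : 0 < n) hut]
    · refine hN t ?_ (hd'' t ht)
      by_contra! htN
      nlinarith [hw_le k, Nat.mul_le_mul_left (2 * n) htN.le]
end

section
/- Let S' ≤ S'' be additive submonoids of ℕ with S' ≠ {0} and the pair (S', S'') equi-gcd. Then for every n ≥ 3, the set of additive submonoids S of ℕ such that S ≤ S'', the pair (S, S'') is equi-gcd, {t ∈ S'' : n * t ∈ S} = (S' : Set ℕ) (i.e. S' is the n-th radical of S in S''), and S is pseudo-symmetric in S'' (i.e. PF(S''/S) = {v, 2*v} for some v ≠ 0), is infinite. -/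
theorem AddSubmonoid.exists_forall_dvd_and_forall_ge_mem {S : AddSubmonoid ℕ} (hS : S ≠ ⊥) :
    ∃ d c : ℕ, d ≠ 0 ∧ (∀ x ∈ S, d ∣ x) ∧ ∀ x, d ∣ x → c ≤ x → x ∈ S := by
  obtain ⟨c, hc⟩ := Nat.exists_mem_closure_of_ge (S : Set ℕ)
  refine ⟨Nat.setGcd (S : Set ℕ), c, fun h0 => hS ?_, fun x hx => Nat.setGcd_dvd_of_mem hx,
    fun x hx hcx => ?_⟩
  · refine (AddSubmonoid.eq_bot_iff_forall S).2 fun x hx => ?_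
    have := Nat.setGcd_dvd_of_mem (s := (S : Set ℕ)) hx
    rw [h0] at this
    exact Nat.eq_zero_of_zero_dvd this
  · simpa using hc x hcx hx

theorem pseudoFrobSet_eq_pair {S S'' : AddSubmonoid ℕ} (hle : S ≤ S'') {v : ℕ} (hv : v ∈ S'')
    (hvS : v ∉ S) (h2vS : 2 * v ∉ S)
    (h : ∀ w ∈ S'', w ∉ S → w ≠ v → ∃ s ∈ S, w + s = 2 * v) :
    pseudoFrobSet S S'' = {v, 2 * v} := by
  have h2v : 2 * v ∈ S'' := by simpa using S''.nsmul_mem hv 2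
  ext w
  simp only [pseudoFrobSet, Set.mem_ofPred_eq, Set.mem_insert_iff, Set.mem_singleton_iff]
  constructor
  · rintro ⟨hw, hwS, hadd⟩
    by_contra! hne
    obtain ⟨s, hs, hws⟩ := h w hw hwS hne.1
    exact h2vS (hws ▸ hadd s hs (by rintro rfl; omega))
  · rintro (rfl | rfl)
    · refine ⟨hv, hvS, fun s hs hs0 => by_contra fun hn => ?_⟩
      obtain ⟨r, hr, hrs⟩ := h _ (add_mem hv (hle hs)) hn (by omega)
      exact hvS ((by omega : w = s + r) ▸ add_mem hs hr)
    · refine ⟨h2v, h2vS, fun s hs hs0 => by_contra fun hn => ?_⟩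
      obtain ⟨r, hr, hrs⟩ := h _ (add_mem h2v (hle hs)) hn (by omega)
      omega

/-- The submonoid consisting of the multiples `n * t` with `t ∈ S'`, together with all elements
`x > v` of `S''` that are not of the form `2 * v - n * t` with `t ∈ S'`. -/
def pseudoSymmetricRoot (S' S'' : AddSubmonoid ℕ) (hle : S' ≤ S'') (n v : ℕ) : AddSubmonoid ℕ where
  carrier := {x | (∃ t ∈ S', x = n * t) ∨ (x ∈ S'' ∧ v < x ∧ ∀ t ∈ S', x + n * t ≠ 2 * v)}
  zero_mem' := Or.inl ⟨0, zero_mem _, by simp⟩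
  add_mem' := by
    have hmul : ∀ t ∈ S', n * t ∈ S'' := fun t ht => by simpa using S''.nsmul_mem (hle ht) n
    rintro _ _ (⟨t, ht, rfl⟩ | ⟨hx, hvx, hx'⟩) (⟨u, hu, rfl⟩ | ⟨hy, hvy, hy'⟩)
    · exact Or.inl ⟨t + u, add_mem ht hu, by ring⟩
    · refine Or.inr ⟨add_mem (hmul t ht) hy, by omega, fun r hr h => ?_⟩
      exact hy' (t + r) (add_mem ht hr) (by rw [← h]; ring)
    · refine Or.inr ⟨add_mem hx (hmul u hu), by omega, fun r hr h => ?_⟩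
      exact hx' (u + r) (add_mem hu hr) (by rw [← h]; ring)
    · exact Or.inr ⟨add_mem hx hy, by omega, fun r _ => by omega⟩

theorem mem_pseudoSymmetricRoot {S' S'' : AddSubmonoid ℕ} {hle : S' ≤ S''} {n v x : ℕ} :
    x ∈ pseudoSymmetricRoot S' S'' hle n v ↔
      (∃ t ∈ S', x = n * t) ∨ (x ∈ S'' ∧ v < x ∧ ∀ t ∈ S', x + n * t ≠ 2 * v) :=
  Iff.rfl

section

variable {S' S'' : AddSubmonoid ℕ} {hle : S' ≤ S''} {n v d c : ℕ}

theorem pseudoSymmetricRoot_le : pseudoSymmetricRoot S' S'' hle n v ≤ S'' := by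
  rintro x (⟨t, ht, rfl⟩ | ⟨hx, -⟩)
  · simpa using S''.nsmul_mem (hle ht) n
  · exact hx

theorem equiGcd_pseudoSymmetricRoot (hd0 : d ≠ 0) (hc : ∀ x, d ∣ x → c ≤ x → x ∈ S') :
    EquiGcd (pseudoSymmetricRoot S' S'' hle n v) S'' := by
  refine fun e => ⟨fun h x hx => ?_, fun h x hx => h x (pseudoSymmetricRoot_le hx)⟩
  have hbig : ∀ y ∈ S'', 2 * v < y → e ∣ y := fun y hy hvy =>
    h y (mem_pseudoSymmetricRoot.2 (Or.inr ⟨hy, by omega, fun t _ => by omega⟩))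
  have hN : c + 2 * v + 1 ≤ d * (c + 2 * v + 1) := Nat.le_mul_of_pos_left _ (by omega)
  have hNS := hle (hc (d * (c + 2 * v + 1)) (dvd_mul_right _ _) (by omega))
  exact (Nat.dvd_add_right (hbig _ hNS (by omega))).1 (hbig _ (add_mem hNS hx) (by omega))

theorem radical_pseudoSymmetricRoot (hn : n ≠ 0) (hd : ∀ x ∈ S'', d ∣ x)
    (hc : ∀ x, d ∣ x → c ≤ x → x ∈ S') (hv : n * c ≤ v) :
    {t : ℕ | t ∈ S'' ∧ n * t ∈ pseudoSymmetricRoot S' S'' hle n v} = (S' : Set ℕ) := by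
  ext t
  refine ⟨?_, fun ht => ⟨hle ht, mem_pseudoSymmetricRoot.2 (Or.inl ⟨t, ht, rfl⟩)⟩⟩
  rintro ⟨ht, ⟨u, hu, htu⟩ | ⟨-, hvt, -⟩⟩
  · rwa [Nat.eq_of_mul_eq_mul_left (by omega) htu]
  · exact hc t (hd t ht) (le_of_mul_le_mul_left (hv.trans hvt.le) (by omega))

theorem pseudoFrobSet_pseudoSymmetricRoot (hd : ∀ x ∈ S'', d ∣ x)
    (hc : ∀ x, d ∣ x → c ≤ x → x ∈ S') (hdv : d ∣ v) (hv : c ≤ v) (hnv : ¬ n * d ∣ 2 * v) :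
    pseudoFrobSet (pseudoSymmetricRoot S' S'' hle n v) S'' = {v, 2 * v} := by
  have hnd : ∀ t ∈ S', n * d ∣ n * t := fun t ht => mul_dvd_mul_left n (hd t (hle ht))
  refine pseudoFrobSet_eq_pair pseudoSymmetricRoot_le (hle (hc v hdv hv)) ?_ ?_ ?_
  · rintro (⟨t, ht, h⟩ | ⟨-, h, -⟩)
    · exact hnv (dvd_mul_of_dvd_right (h ▸ hnd t ht) 2)
    · exact lt_irrefl v h
  · rintro (⟨t, ht, h⟩ | ⟨-, -, h⟩)
    · exact hnv (h ▸ hnd t ht)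
    · exact h 0 (zero_mem _) (by simp)
  · intro w hw hwS hwv
    rw [mem_pseudoSymmetricRoot] at hwS
    push Not at hwS
    rcases lt_or_gt_of_ne hwv with hlt | hgt
    · refine ⟨2 * v - w, mem_pseudoSymmetricRoot.2 (Or.inr ⟨hle (hc _ ?_ (by omega)), by omega,
        fun t ht h => hwS.1 t ht (by omega)⟩), by omega⟩
      exact Nat.dvd_sub (dvd_mul_of_dvd_right hdv 2) (hd w hw)
    · obtain ⟨t, ht, h⟩ := hwS.2 hw hgt
      exact ⟨n * t, mem_pseudoSymmetricRoot.2 (Or.inl ⟨t, ht, rfl⟩), h⟩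

end

theorem infinitely_many_pseudosymmetric_radicals (S' S'' : AddSubmonoid ℕ)
    (hle : S' ≤ S'') (hS' : S' ≠ ⊥) (hgcd : EquiGcd S' S'') (n : ℕ) (hn : 3 ≤ n) :
    {S : AddSubmonoid ℕ | S ≤ S'' ∧ EquiGcd S S'' ∧
      {t : ℕ | t ∈ S'' ∧ n * t ∈ S} = (S' : Set ℕ) ∧
      ∃ v : ℕ, v ≠ 0 ∧ pseudoFrobSet S S'' = {v, 2 * v}}.Infinite := by
  obtain ⟨d, c, hd0, hdS', hc⟩ := AddSubmonoid.exists_forall_dvd_and_forall_ge_mem hS'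
  have hd := (hgcd d).1 hdS'
  let v : ℕ → ℕ := fun k => d * (n * (c + k) + 1)
  have hnc : ∀ k, n * c < v k := fun k => calc
    n * c < n * (c + k) + 1 := by rw [mul_add]; omega
    _ ≤ v k := Nat.le_mul_of_pos_left _ (by omega)
  have hcv : ∀ k, c ≤ v k := fun k =>
    (Nat.le_mul_of_pos_left c (by omega : 0 < n)).trans (hnc k).le
  have hnv : ∀ k, ¬ n * d ∣ 2 * v k := by
    intro k h
    have h1 : n ∣ 2 * (n * (c + k) + 1) := by
      refine Nat.dvd_of_mul_dvd_mul_left (Nat.pos_of_ne_zero hd0) ?_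
      rwa [mul_comm d n, mul_left_comm d 2]
    have h2 : n ∣ 2 := by
      refine (Nat.dvd_add_right (dvd_mul_right n (2 * (c + k)))).1 ?_
      convert h1 using 1; ring
    have := Nat.le_of_dvd (by omega) h2
    omega
  have hpf : ∀ k, pseudoFrobSet (pseudoSymmetricRoot S' S'' hle n (v k)) S'' = {v k, 2 * v k} :=
    fun k => pseudoFrobSet_pseudoSymmetricRoot hd hc (dvd_mul_right _ _) (hcv k) (hnv k)
  refine Set.infinite_of_injective_forall_mem
    (f := fun k => pseudoSymmetricRoot S' S'' hle n (v k)) (fun j k hjk => ?_) fun k =>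
      ⟨pseudoSymmetricRoot_le, equiGcd_pseudoSymmetricRoot hd0 hc,
        radical_pseudoSymmetricRoot (by omega) hd hc (hnc k).le, v k,
        ((Nat.zero_le _).trans_lt (hnc k)).ne', hpf k⟩
  have hset : ({v j, 2 * v j} : Set ℕ) = {v k, 2 * v k} := by
    rw [← hpf j, ← hpf k]
    exact congrArg (pseudoFrobSet · S'') hjk
  have hj : v j ∈ ({v k, 2 * v k} : Set ℕ) := hset ▸ Set.mem_insert _ _
  have hk : v k ∈ ({v j, 2 * v j} : Set ℕ) := hset ▸ Set.mem_insert _ _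
  simp only [Set.mem_insert_iff, Set.mem_singleton_iff] at hj hk
  have hvjk : v j = v k := by omega
  have h := Nat.eq_of_mul_eq_mul_left (Nat.pos_of_ne_zero hd0) hvjk
  have h' := Nat.eq_of_mul_eq_mul_left (by omega) (Nat.add_right_cancel h)
  omega
end

section
/- Let S' be an additive submonoid of ℕ. Then the set of additive submonoids S of ℕ such that S ≤ S', the pair (S, S') is equi-gcd, and FG(S'/S) = {t} for some t (a single fundamental gap), is finite. -/
/-- If `S` and `S'` are equi-gcd, every gap has a multiple which is a fundamental gap. -/
theorem exists_mul_mem_fundGapSet {S S' : AddSubmonoid ℕ} (hgcd : EquiGcd S S') {x : ℕ}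
    (hx : x ∈ S') (hxS : x ∉ S) : ∃ k : ℕ, k * x ∈ fundGapSet S S' := by
  classical
  obtain ⟨c, hc⟩ := Nat.exists_mem_closure_of_ge (S : Set ℕ)
  rw [AddSubmonoid.closure_eq] at hc
  have hdvd : Nat.setGcd (S : Set ℕ) ∣ x :=
    (hgcd _).1 (fun y hy => Nat.setGcd_dvd_of_mem hy) x hx
  have hx0 : 0 < x := Nat.pos_of_ne_zero fun h => hxS (h ▸ S.zero_mem)
  have hlarge : ∀ k, c ≤ k → k * x ∈ S := fun k hk =>
    hc _ (hk.trans (Nat.le_mul_of_pos_right k hx0)) (hdvd.mul_left k)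
  have hc0 : 1 ≤ c := by
    by_contra h
    exact hxS (by simpa using hlarge 1 (by omega))
  set k := Nat.findGreatest (fun n => n * x ∉ S) c with hk
  have hkS : k * x ∉ S :=
    Nat.findGreatest_spec (P := fun n => n * x ∉ S) hc0 (by simpa using hxS)
  have hk0 : 0 < k := Nat.pos_of_ne_zero fun h => hkS (by simp [h])
  have hmax : ∀ n, k < n → n * x ∈ S := by
    intro n hn
    by_cases hnc : n ≤ c
    · exact not_not.1 (Nat.findGreatest_is_greatest hn hnc)
    · exact hlarge n (by omega)
  refine ⟨k, ?_, hkS, ?_, ?_⟩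
  · simpa using S'.nsmul_mem hx k
  · simpa [mul_assoc] using hmax (2 * k) (by omega)
  · simpa [mul_assoc] using hmax (3 * k) (by omega)

/-- If `t` is the only fundamental gap, every gap divides `t`. -/
theorem dvd_of_fundGapSet_eq_singleton {S S' : AddSubmonoid ℕ} (hgcd : EquiGcd S S') {t x : ℕ}
    (ht : fundGapSet S S' = {t}) (hx : x ∈ S') (hxS : x ∉ S) : x ∣ t := by
  obtain ⟨k, hk⟩ := exists_mul_mem_fundGapSet hgcd hx hxS
  rw [ht, Set.mem_singleton_iff] at hk
  exact ⟨k, by rw [← hk, mul_comm]⟩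

theorem not_dvd_of_lt_two_mul {a t : ℕ} (hat : a < t) (h : t < 2 * a) : ¬ a ∣ t := by
  rintro ⟨k, rfl⟩
  have h1 : 1 < k := lt_of_mul_lt_mul_left (a := a) (by simpa using hat) a.zero_le
  have h2 : k < 2 := lt_of_mul_lt_mul_left (a := a) (by linarith) a.zero_le
  omega

theorem not_dvd_of_lt_three_mul {a t : ℕ} (hat : 2 * a < t) (h : t < 3 * a) : ¬ a ∣ t := by
  rintro ⟨k, rfl⟩
  have h1 : 2 < k := lt_of_mul_lt_mul_left (a := a) (by linarith) a.zero_le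
  have h2 : k < 3 := lt_of_mul_lt_mul_left (a := a) (by linarith) a.zero_le
  omega

/-- The single fundamental gap of an equi-gcd pair is bounded in terms of `S'` only. -/
theorem exists_bound_single_fundGap (S' : AddSubmonoid ℕ) :
    ∃ T : ℕ, ∀ S : AddSubmonoid ℕ, EquiGcd S S' →
      ∀ t : ℕ, fundGapSet S S' = {t} → t ≤ T := by
  obtain ⟨c, hc⟩ := Nat.exists_mem_closure_of_ge (S' : Set ℕ)
  rw [AddSubmonoid.closure_eq] at hc
  set g := Nat.setGcd (S' : Set ℕ) with hg
  refine ⟨3 * c + 6 * g, fun S hgcd t ht => ?_⟩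
  have htf : t ∈ fundGapSet S S' := ht ▸ Set.mem_singleton t
  obtain ⟨m, hm⟩ : g ∣ t := Nat.setGcd_dvd_of_mem htf.1
  by_contra! hlt
  have hg0 : 0 < g := Nat.pos_of_ne_zero fun h => by
    rw [h, zero_mul] at hm
    omega
  have hm6 : 6 < m := lt_of_mul_lt_mul_left (a := g) (by linarith) g.zero_le
  obtain ⟨p, q, hpq, h3, h2⟩ : ∃ p q : ℕ, p + q = m ∧ m < 3 * p ∧ 2 * p < m :=
    ⟨m / 3 + 1, m - (m / 3 + 1), by omega, by omega, by omega⟩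
  have hsum : g * p + g * q = t := by rw [hm, ← hpq, mul_add]
  have h3g : t < 3 * (g * p) := by nlinarith
  have h2g : 2 * (g * p) < t := by nlinarith
  refine htf.2.1 (hsum ▸ S.add_mem ?_ ?_)
  · by_contra hS
    exact not_dvd_of_lt_three_mul h2g h3g <|
      dvd_of_fundGapSet_eq_singleton hgcd ht (hc _ (by omega) (dvd_mul_right g p)) hS
  · by_contra hS
    exact not_dvd_of_lt_two_mul (by omega) (by omega) <|
      dvd_of_fundGapSet_eq_singleton hgcd ht (hc _ (by omega) (dvd_mul_right g q)) hS

theorem finitely_many_single_fund_gap (S' : AddSubmonoid ℕ) :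
    {S : AddSubmonoid ℕ | S ≤ S' ∧ EquiGcd S S' ∧
      ∃ t : ℕ, fundGapSet S S' = {t}}.Finite := by
  obtain ⟨T, hT⟩ := exists_bound_single_fundGap S'
  refine Set.Finite.of_finite_image (f := fun S => gapSet S S')
    ((Set.finite_Iic T).finite_subsets.subset ?_) ?_
  · rintro _ ⟨S, ⟨-, hgcd, t, ht⟩, rfl⟩ x ⟨hx, hxS⟩
    have htf : t ∈ fundGapSet S S' := ht ▸ Set.mem_singleton t
    have ht0 : 0 < t := Nat.pos_of_ne_zero fun h => htf.2.1 (h ▸ S.zero_mem)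
    exact (Nat.le_of_dvd ht0 (dvd_of_fundGapSet_eq_singleton hgcd ht hx hxS)).trans
      (hT S hgcd t ht)
  · rintro S₁ ⟨h₁, -⟩ S₂ ⟨h₂, -⟩ heq
    apply SetLike.coe_injective
    rw [← Set.sdiff_sdiff_cancel_left (SetLike.coe_subset_coe.2 h₁),
      ← Set.sdiff_sdiff_cancel_left (SetLike.coe_subset_coe.2 h₂)]
    exact congrArg (fun G => (S' : Set ℕ) \ G) heq
end
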